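/- Let P ∈ ℤ[X] be a separable polynomial (nonzero, coprime to its derivative in ℚ[X]). Then the series ∑_{p prime} ν_P(p²)/p², taken over all prime numbers p, converges. -/

import Mathlib

open Polynomial

/-- `nuP P M` is the number of residues `m ∈ {0, …, M-1}` with `P(m) ≡ 0 (mod M)`. -/
def nuP (P : Polynomial ℤ) (M : ℕ) : ℕ :=
  ((Finset.range M).filter fun m : ℕ => (M : ℤ) ∣ P.eval (m : ℤ)).card

/-- A polynomial over `ℚ` has a nonzero integer multiple with integer coefficients. -/
lemma exists_int_mul_eq_map (a : ℚ[X]) :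
    ∃ (d : ℤ) (A : ℤ[X]), d ≠ 0 ∧ A.map (Int.castRingHom ℚ) = C (d : ℚ) * a := by
  obtain ⟨d, hd0, hd⟩ := IsLocalization.integerNormalization_spec (nonZeroDivisors ℤ) a
  refine ⟨d, _, nonZeroDivisors.ne_zero hd0, hd.trans ?_⟩
  ext n
  simp

/-- Denominators can be cleared in the Bézout identity for a polynomial and its derivative. -/
lemma exists_bezout_int (P : ℤ[X])
    (hsep : IsCoprime (P.map (Int.castRingHom ℚ)) (derivative (P.map (Int.castRingHom ℚ)))) :
    ∃ (D : ℤ) (A B : ℤ[X]), D ≠ 0 ∧ A * P + B * derivative P = C D := by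
  obtain ⟨a, b, hab⟩ := hsep
  obtain ⟨d, A, hd, hA⟩ := exists_int_mul_eq_map a
  obtain ⟨e, B, he, hB⟩ := exists_int_mul_eq_map b
  refine ⟨d * e, C e * A, C d * B, mul_ne_zero hd he, ?_⟩
  apply Polynomial.map_injective (Int.castRingHom ℚ) Int.cast_injective
  simp only [Polynomial.map_add, Polynomial.map_mul, hA, hB, Polynomial.map_C, Int.coe_castRingHom,
    ← derivative_map, C_mul]
  linear_combination (C (d : ℚ) * C (e : ℚ)) * hab

/-- Away from the primes dividing `D`, roots modulo `p ^ 2` number at most the degree. -/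
lemma nuP_sq_le_natDegree {P A B : ℤ[X]} {D : ℤ} (h : A * P + B * derivative P = C D)
    {p : ℕ} (hp : p.Prime) (hD : ¬ (p : ℤ) ∣ D) : nuP P (p ^ 2) ≤ P.natDegree := by
  have : Fact p.Prime := ⟨hp⟩
  have hp' : Prime (p : ℤ) := Nat.prime_iff_prime_int.mp hp
  set Q := P.map (Int.castRingHom (ZMod p)) with hQ
  have hQ0 : Q ≠ 0 := by
    intro h0
    apply hD
    have h1 := congrArg (Polynomial.map (Int.castRingHom (ZMod p))) h
    simp only [Polynomial.map_add, Polynomial.map_mul, ← derivative_map, ← hQ, h0, mul_zero,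
      derivative_zero, add_zero, Polynomial.map_C, Int.coe_castRingHom] at h1
    exact (ZMod.intCast_zmod_eq_zero_iff_dvd D p).mp (C_eq_zero.mp h1.symm)
  calc nuP P (p ^ 2) ≤ Q.roots.toFinset.card := by
        apply Finset.card_le_card_of_injOn (fun m : ℕ => (m : ZMod p))
        · intro m hm
          simp only [Finset.coe_filter, Finset.mem_range, Set.mem_ofPred_eq] at hm
          have h1 : (p : ℤ) ∣ P.eval (m : ℤ) :=
            (Dvd.intro_left (p : ℤ) (by push_cast; ring)).trans hm.2
          simp only [Finset.mem_coe, Multiset.mem_toFinset]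
          rw [mem_roots hQ0, IsRoot.def, hQ]
          have h2 := eval_intCast_map (Int.castRingHom (ZMod p)) P (m : ℤ)
          rw [Int.cast_natCast] at h2
          rw [h2, eq_intCast]
          exact (ZMod.intCast_zmod_eq_zero_iff_dvd _ p).mpr h1
        · intro m hm n hn hmn
          simp only [Finset.coe_filter, Finset.mem_range, Set.mem_ofPred_eq] at hm hn
          obtain ⟨hm, hPm⟩ := hm
          obtain ⟨hn, hPn⟩ := hn
          push_cast at hPm hPn
          have hdvd : (p : ℤ) ∣ (n : ℤ) - m :=
            (Nat.modEq_iff_dvd).mp ((ZMod.natCast_eq_natCast_iff _ _ _).mp hmn)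
          obtain ⟨k, hk⟩ := P.binomExpansion (m : ℤ) ((n : ℤ) - m)
          rw [add_sub_cancel] at hk
          have hder : ¬ (p : ℤ) ∣ (derivative P).eval (m : ℤ) := by
            intro h1
            apply hD
            have h2 := congrArg (Polynomial.eval (m : ℤ)) h
            simp only [eval_add, eval_mul, eval_C] at h2
            rw [← h2]
            exact dvd_add (((dvd_pow_self _ two_ne_zero).trans hPm).mul_left _) (h1.mul_left _)
          have h3 : (p : ℤ) ^ 2 ∣ (derivative P).eval (m : ℤ) * ((n : ℤ) - m) := by
            have h4 : (derivative P).eval (m : ℤ) * ((n : ℤ) - m)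
                = P.eval (n : ℤ) - P.eval (m : ℤ) - k * ((n : ℤ) - m) ^ 2 := by
              linear_combination -hk
            rw [h4]
            exact dvd_sub (dvd_sub hPn hPm) ((pow_dvd_pow_of_dvd hdvd 2).mul_left _)
          have h5 := hp'.pow_dvd_of_dvd_mul_left 2 hder h3
          have h6 : m ≡ n [MOD p ^ 2] := Nat.modEq_iff_dvd.mpr (by exact_mod_cast h5)
          exact h6.eq_of_lt_of_lt hm hn
    _ ≤ Q.roots.card := Multiset.toFinset_card_le _
    _ ≤ Q.natDegree := card_roots' Q
    _ ≤ P.natDegree := natDegree_map_le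

theorem stmt_4 (P : Polynomial ℤ) (hP : P ≠ 0)
    (hsep : IsCoprime (P.map (Int.castRingHom ℚ)) (derivative (P.map (Int.castRingHom ℚ)))) :
    Summable (fun p : Nat.Primes => (nuP P ((p : ℕ) ^ 2) : ℝ) / ((p : ℕ) : ℝ) ^ 2) := by
  obtain ⟨D, A, B, hD, h⟩ := exists_bezout_int P hsep
  have hsum : Summable fun p : Nat.Primes => (P.natDegree : ℝ) * (1 / ((p : ℕ) : ℝ) ^ 2) :=
    ((Real.summable_one_div_nat_pow.mpr one_lt_two).comp_injective
      Nat.Primes.coe_nat_injective).mul_left _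
  refine Summable.of_norm_bounded_eventually hsum ?_
  have hfin : {p : Nat.Primes | ((p : ℕ) : ℤ) ∣ D}.Finite := by
    refine Set.Finite.of_finite_image (f := fun p : Nat.Primes => (p : ℕ)) ?_
      Nat.Primes.coe_nat_injective.injOn
    refine (Set.finite_Iic D.natAbs).subset ?_
    rintro _ ⟨p, hp, rfl⟩
    exact Nat.le_of_dvd (Int.natAbs_pos.mpr hD) (Int.natCast_dvd.mp hp)
  filter_upwards [hfin.compl_mem_cofinite] with p hp
  rw [Real.norm_of_nonneg (by positivity), mul_one_div]
  gcongr
  exact nuP_sq_le_natDegree h p.2 hp
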